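/- Let q be a prime power, n ≥ 5 an odd integer, and L = PSp_{2n}(q). Let s1 and s2 be primes such that the multiplicative order of q modulo s1 equals 2n and the multiplicative order of q modulo s2 equals n. Then: (i) s1·s2 ∉ ω(L) and there is no prime r with both r·s1 ∈ ω(L) and r·s2 ∈ ω(L); (ii) the number m1 = (q^n+1)/gcd(2,q−1) lies in ω(L) and every element of ω(L) divisible by s1 divides m1; likewise m2 = (q^n−1)/gcd(2,q−1) lies in ω(L) and every element of ω(L) divisible by s2 divides m2. -/

import Mathlib

/-- The spectrum of a group `G`: the set of element orders of `G`. -/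
def elementOrders (G : Type*) [Monoid G] : Set ℕ := {n | ∃ g : G, orderOf g = n}

/-- `PSL n F`: the projective special linear group over `F`,
i.e. the quotient of `SL_n(F)` by its center. -/
abbrev PSL (n : ℕ) (F : Type*) [Field F] :=
  Matrix.SpecialLinearGroup (Fin n) F ⧸
    Subgroup.center (Matrix.SpecialLinearGroup (Fin n) F)

/-- `PSp n F`: the projective symplectic group, i.e. the quotient of the
symplectic group `Sp_{2n}(F)` (2n×2n matrices preserving the standard symplectic
form) by its center. -/
abbrev PSp (n : ℕ) (F : Type*) [Field F] :=
  Matrix.symplecticGroup (Fin n) F ⧸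
    Subgroup.center (Matrix.symplecticGroup (Fin n) F)

/-- `G` is an almost simple group with socle isomorphic to `L`: there is an
injective homomorphism `ι : G → Aut L` whose image contains the inner
automorphisms `Inn L`. -/
def IsAlmostSimpleWithSocle (G : Type*) [Group G] (L : Type*) [Group L] : Prop :=
  ∃ ι : G →* MulAut L, Function.Injective ι ∧ (MulAut.conj (G := L)).range ≤ ι.range

section SpectrumArguments

open Polynomial

theorem Matrix.aeval_eq_zero_of_charpoly_roots {F E ι : Type*} [Field F] [Field E] [Algebra F E]
    [Fintype ι] [DecidableEq ι] (A : Matrix ι ι F) (S : Finset E)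
    (hcard : S.card = Fintype.card ι) (hS : ∀ x ∈ S, aeval x A.charpoly = 0) (P : F[X])
    (hP : ∀ x ∈ S, aeval x P = 0) : aeval A P = 0 := by
  by_cases hP0 : P = 0
  · simp [hP0]
  have hle : ∀ Q : F[X], Q ≠ 0 → (∀ x ∈ S, aeval x Q = 0) →
      S.val ≤ (Q.map (algebraMap F E)).roots := fun Q hQ0 hQ ↦
    (Multiset.le_iff_subset S.nodup).2 fun x hx ↦ by
      rw [mem_roots (Polynomial.map_ne_zero hQ0), IsRoot.def, eval_map_algebraMap]
      exact hQ x hx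
  have hmonic := A.charpoly_monic.map (algebraMap F E)
  have hdeg : (A.charpoly.map (algebraMap F E)).natDegree = S.card := by
    rw [natDegree_map, A.charpoly_natDegree_eq_dim, hcard]
  have hroots : S.val = (A.charpoly.map (algebraMap F E)).roots :=
    Multiset.eq_of_le_of_card_le (hle _ A.charpoly_monic.ne_zero hS)
      ((card_roots' _).trans hdeg.le)
  have hprod := prod_multiset_X_sub_C_of_monic_of_roots_card_eq hmonic
    (by rw [← hroots, hdeg]; rfl)
  have hdvd : A.charpoly.map (algebraMap F E) ∣ P.map (algebraMap F E) := by
    rw [← hprod, ← hroots, Multiset.prod_X_sub_C_dvd_iff_le_roots (Polynomial.map_ne_zero hP0)]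
    exact hle P hP0 hP
  obtain ⟨R, rfl⟩ := (Polynomial.map_dvd_map' _).1 hdvd
  simp [Matrix.aeval_self_charpoly]

theorem Matrix.mem_of_aeval_charpoly_eq_zero {F E ι : Type*} [Field F] [Field E] [Algebra F E]
    [Fintype ι] [DecidableEq ι] (A : Matrix ι ι F) (S : Finset E)
    (hcard : S.card = Fintype.card ι) (hS : ∀ x ∈ S, aeval x A.charpoly = 0) {x : E}
    (hx : aeval x A.charpoly = 0) : x ∈ S := by
  classical
  by_contra hxS
  have hsub : (insert x S).val ≤ (A.charpoly.map (algebraMap F E)).roots :=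
    (Multiset.le_iff_subset (insert x S).nodup).2 fun y hy ↦ by
      rw [mem_roots (Polynomial.map_ne_zero A.charpoly_monic.ne_zero), IsRoot.def,
        eval_map_algebraMap]
      rcases Finset.mem_insert.1 hy with rfl | hy
      exacts [hx, hS _ hy]
  have h := (Multiset.card_le_card hsub).trans (card_roots' _)
  rw [natDegree_map, A.charpoly_natDegree_eq_dim, Finset.card_val,
    Finset.card_insert_of_notMem hxS, hcard] at h
  omega

theorem Matrix.exists_charpoly_root_orderOf_pow {F E ι : Type*} [Field F] [Field E] [Algebra F E]
    [IsAlgClosed E] [Fintype ι] [DecidableEq ι] (A : Matrix ι ι F) {s k : ℕ} (hs : s.Prime)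
    (hsF : (s : F) ≠ 0) (hA : orderOf (A ^ k) = s) :
    ∃ x : E, aeval x A.charpoly = 0 ∧ orderOf (x ^ k) = s := by
  set B := A.map (algebraMap F E) with hB
  have hinj : Function.Injective ((algebraMap F E).mapMatrix : Matrix ι ι F →+* Matrix ι ι E) :=
    Matrix.map_injective (algebraMap F E).injective
  have hBk : orderOf (B ^ k) = s := by
    rw [← hA, ← orderOf_injective
      ((algebraMap F E).mapMatrix : Matrix ι ι F →+* Matrix ι ι E).toMonoidHom hinj (A ^ k)]
    simp [hB, Matrix.map_pow]
  have hB1 : B ^ k ≠ 1 := fun h ↦ hs.one_lt.ne' (by rw [← hBk, h, orderOf_one])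
  have hι : Nonempty ι := by
    by_contra h
    rw [not_nonempty_iff] at h
    exact hB1 (Subsingleton.elim _ _)
  set p : E[X] := (∑ i ∈ Finset.range s, X ^ i).comp (X ^ k) with hp
  have hunit : ¬ IsUnit (aeval B p) := by
    intro hu
    have h0 : (aeval B p) * (B ^ k - 1) = 0 := by
      simp only [hp, aeval_comp, map_pow, aeval_X, map_sum]
      rw [geom_sum_mul, ← hBk, pow_orderOf_eq_one, sub_self]
    exact hB1 (sub_eq_zero.1 (hu.mul_right_eq_zero.1 h0))
  have h0 : (0 : E) ∈ spectrum E (aeval B p) := spectrum.zero_mem_iff E |>.2 hunit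
  rw [spectrum.map_polynomial_aeval_of_nonempty B p
    (spectrum.nonempty_of_isAlgClosed_of_finiteDimensional E B)] at h0
  obtain ⟨x, hx, hpx⟩ := h0
  refine ⟨x, ?_, ?_⟩
  · rw [Matrix.mem_spectrum_iff_isRoot_charpoly, hB, Matrix.charpoly_map] at hx
    rwa [IsRoot.def, eval_map_algebraMap] at hx
  · have hsum : ∑ i ∈ Finset.range s, (x ^ k) ^ i = 0 := by
      simpa [hp, eval_comp, eval_finsetSum] using hpx
    have : Fact s.Prime := ⟨hs⟩
    refine orderOf_eq_prime ?_ fun h1 ↦ ?_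
    · rw [← sub_eq_zero, ← geom_sum_mul, hsum, zero_mul]
    · rw [h1] at hsum
      simp only [one_pow, Finset.sum_const, Finset.card_range, nsmul_eq_mul, mul_one] at hsum
      exact hsF ((algebraMap F E).injective (by simpa using hsum))

theorem SymplecticGroup.aeval_inv_charpoly {F E l : Type*} [Field F] [Field E] [Algebra F E]
    [Fintype l] [DecidableEq l] {A : Matrix (l ⊕ l) (l ⊕ l) F}
    (hA : A ∈ Matrix.symplecticGroup l F) {x : E} (hx : aeval x A.charpoly = 0) :
    x ≠ 0 ∧ aeval x⁻¹ A.charpoly = 0 := by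
  set B := A.map (algebraMap F E) with hB
  have hmem : B ∈ Matrix.symplecticGroup l E := SymplecticGroup.map_mem hA _
  have hiff : ∀ y : E, aeval y A.charpoly = 0 ↔ y ∈ spectrum E B := fun y ↦ by
    rw [Matrix.mem_spectrum_iff_isRoot_charpoly, hB, Matrix.charpoly_map, IsRoot.def,
      eval_map_algebraMap]
  have hBu : IsUnit B := (Matrix.isUnit_iff_isUnit_det _).2 (SymplecticGroup.symplectic_det hmem)
  rw [hiff] at hx
  have hx0 : x ≠ 0 := by
    rintro rfl
    exact spectrum.zero_notMem E hBu hx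
  refine ⟨hx0, ?_⟩
  rw [Matrix.mem_spectrum_iff_isRoot_charpoly, ← Matrix.charpoly_transpose,
    ← Matrix.mem_spectrum_iff_isRoot_charpoly] at hx
  rw [hiff]
  contrapose! hx
  rw [spectrum.notMem_iff] at hx ⊢
  have hJ : IsUnit (Matrix.J l E) := (Matrix.isUnit_iff_isUnit_det _).2 (Matrix.isUnit_det_J l E)
  have key : (B * Matrix.J l E) * (algebraMap E _ x - B.transpose)
      = (-x) • ((algebraMap E _ x⁻¹ - B) * Matrix.J l E) := by
    rw [mul_sub, SymplecticGroup.mem_iff.1 hmem, Algebra.algebraMap_eq_smul_one,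
      Algebra.algebraMap_eq_smul_one, sub_mul, smul_sub, Matrix.mul_smul, Matrix.smul_mul,
      smul_smul, mul_one, one_mul, neg_mul, mul_inv_cancel₀ hx0, neg_smul, neg_smul, one_smul]
    abel
  rw [← (hBu.mul hJ).mul_left_iff, key]
  have hxu : IsUnit (-x) := hx0.isUnit.neg
  exact (hx.mul hJ).smul hxu.unit

theorem FiniteField.aeval_pow_card_pow_eq_zero {F E : Type*} [Field F] [Fintype F] [Field E]
    [Algebra F E] {P : F[X]} {x : E} (hx : aeval x P = 0) (i : ℕ) :
    aeval (x ^ Fintype.card F ^ i) P = 0 := by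
  induction i with
  | zero => simpa
  | succ i ih =>
    have h := aeval_algHom_apply (FiniteField.frobeniusAlgHom F E) (x ^ Fintype.card F ^ i) P
    rw [ih, map_zero, FiniteField.coe_frobeniusAlgHom] at h
    rwa [pow_succ, pow_mul]

theorem ZMod.pow_ne_neg_pow_of_odd_orderOf {s n : ℕ} [Fact s.Prime] (hs : s ≠ 2) {a : ZMod s}
    (ha : orderOf a = n) (hn : Odd n) (i j : ℕ) : a ^ i ≠ -a ^ j := by
  intro h
  have ha0 : a ≠ 0 := by
    rintro rfl
    rw [orderOf_zero] at ha
    simp [← ha] at hn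
  have h1 : (a ^ n) ^ i = -(a ^ n) ^ j := by
    rw [← pow_mul, ← pow_mul, mul_comm n, mul_comm n, pow_mul, h, hn.neg_pow, pow_mul]
  rw [← ha, pow_orderOf_eq_one, one_pow, one_pow] at h1
  have : Fact (2 < s) := ⟨by have := (Fact.out : s.Prime).two_le; omega⟩
  exact ZMod.neg_one_ne_one h1.symm

theorem Matrix.pow_eq_one_or_neg_one_of_charpoly_roots {F E : Type*} [Field F] [Fintype F] [Field E]
    [Algebra F E] {ι : Type*} [Fintype ι] [DecidableEq ι] {A : Matrix ι ι F} (S : Finset E)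
    (hcard : S.card = Fintype.card ι) (hS : ∀ x ∈ S, aeval x A.charpoly = 0) {x : E} {m d : ℕ}
    (hd : d ∣ 2) (hx : x ^ (d * m) = 1)
    (hSx : ∀ y ∈ S, ∃ i, y = x ^ Fintype.card F ^ i ∨ y = (x ^ Fintype.card F ^ i)⁻¹) :
    A ^ m = 1 ∨ A ^ m = -1 := by
  have hx2 : (x ^ m) ^ 2 = 1 := by
    obtain ⟨e, he⟩ := hd
    rw [← pow_mul, mul_comm, he, mul_right_comm, pow_mul, hx, one_pow]
  obtain ⟨c, hc, hcx⟩ : ∃ c : F, (c = 1 ∨ c = -1) ∧ algebraMap F E c = x ^ m := by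
    rw [sq, mul_self_eq_one_iff] at hx2
    rcases hx2 with h | h
    · exact ⟨1, .inl rfl, by simp [h]⟩
    · exact ⟨-1, .inr rfl, by simp [h]⟩
  have hroot : ∀ y ∈ S, aeval y (X ^ m - C c) = 0 := fun y hy ↦ by
    obtain ⟨i, hi⟩ := hSx y hy
    have hpow : (x ^ Fintype.card F ^ i) ^ m = algebraMap F E c := by
      rw [← pow_mul, mul_comm, pow_mul, ← hcx, ← map_pow, FiniteField.pow_card_pow]
    have hinv : (algebraMap F E c)⁻¹ = algebraMap F E c := by
      rcases hc with rfl | rfl <;> simp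
    rw [map_sub, map_pow, aeval_X, aeval_C, sub_eq_zero]
    rcases hi with rfl | rfl
    · exact hpow
    · rw [inv_pow, hpow, hinv]
  have hA := A.aeval_eq_zero_of_charpoly_roots S hcard hS _ hroot
  rw [map_sub, map_pow, aeval_X, aeval_C, sub_eq_zero] at hA
  rcases hc with rfl | rfl
  · exact .inl (by simpa using hA)
  · exact .inr (by simpa using hA)

theorem SymplecticGroup.pow_eq_one_or_neg_one_of_orderOf_eq_two_mul {F : Type*} [Field F]
    [Fintype F] {n s k m d : ℕ} (hs : s.Prime) (hs2 : s ≠ 2)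
    (ho : orderOf (Fintype.card F : ZMod s) = 2 * n)
    {A : Matrix (Fin n ⊕ Fin n) (Fin n ⊕ Fin n) F}
    (hA : A ∈ Matrix.symplecticGroup (Fin n) F) (hk : orderOf (A ^ k) = s) (hsF : (s : F) ≠ 0)
    (hd : d ∣ 2) (hm : d * m = Fintype.card F ^ n + 1) : A ^ m = 1 ∨ A ^ m = -1 := by
  classical
  set q := Fintype.card F with hq
  obtain ⟨x, hx, hxk⟩ := A.exists_charpoly_root_orderOf_pow (E := AlgebraicClosure F) hs hsF hk
  have hfr := FiniteField.aeval_pow_card_pow_eq_zero hx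
  have hinj : Set.InjOn (fun i ↦ x ^ q ^ i) (Finset.range (2 * n)) := fun i hi j hj hij ↦ by
    have h : (x ^ k) ^ q ^ i = (x ^ k) ^ q ^ j := by
      rw [pow_right_comm, pow_right_comm x k]
      exact congrArg (· ^ k) hij
    rw [IsOfFinOrder.pow_eq_pow_iff_modEq (orderOf_pos_iff.1 (hxk ▸ hs.pos)), hxk,
      ← ZMod.natCast_eq_natCast_iff] at h
    push_cast at h
    rw [Finset.coe_range] at hi hj
    exact pow_injOn_Iio_orderOf (ho ▸ hi) (ho ▸ hj) h
  set S := (Finset.range (2 * n)).image fun i ↦ x ^ q ^ i with hS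
  have hcard : S.card = Fintype.card (Fin n ⊕ Fin n) := by
    rw [Finset.card_image_of_injOn hinj]
    simp [two_mul]
  have hSroot : ∀ y ∈ S, aeval y A.charpoly = 0 := fun y hy ↦ by
    obtain ⟨i, -, rfl⟩ := Finset.mem_image.1 hy
    exact hfr i
  obtain ⟨hx0, hxinv⟩ := SymplecticGroup.aeval_inv_charpoly hA hx
  obtain ⟨i, hi, hix⟩ := Finset.mem_image.1 (A.mem_of_aeval_charpoly_eq_zero S hcard hSroot hxinv)
  rw [Finset.mem_range] at hi
  have hx1 : x ^ (q ^ i + 1) = 1 := by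
    rw [pow_succ]
    exact (congrArg (· * x) hix).trans (inv_mul_cancel₀ hx0)
  have hsi : (q : ZMod s) ^ i = -1 := by
    have h1 : s ∣ q ^ i + 1 := by
      rw [← hxk]
      apply orderOf_dvd_of_pow_eq_one
      rw [pow_right_comm, hx1, one_pow]
    rw [eq_neg_iff_add_eq_zero]
    exact_mod_cast (ZMod.natCast_eq_zero_iff _ _).2 h1
  have hdvd : 2 * n ∣ 2 * i := by
    rw [← ho]
    apply orderOf_dvd_of_pow_eq_one
    rw [mul_comm, pow_mul, hsi]
    simp
  obtain ⟨c, hc⟩ := Nat.dvd_of_mul_dvd_mul_left two_pos hdvd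
  have hin : i = n := by
    have hc2 : c < 2 := by
      by_contra hcon
      have := Nat.mul_le_mul_left n (not_lt.1 hcon)
      omega
    interval_cases c
    · exfalso
      rw [hc, mul_zero, pow_zero] at hsi
      have : Fact (2 < s) := ⟨by have := hs.two_le; omega⟩
      exact ZMod.neg_one_ne_one hsi.symm
    · simpa using hc
  refine Matrix.pow_eq_one_or_neg_one_of_charpoly_roots S hcard hSroot hd
    (hm ▸ hin ▸ hx1) fun y hy ↦ ?_
  obtain ⟨j, -, rfl⟩ := Finset.mem_image.1 hy
  exact ⟨j, .inl rfl⟩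

theorem SymplecticGroup.pow_eq_one_or_neg_one_of_orderOf_eq {F : Type*} [Field F]
    [Fintype F] {n s k m d : ℕ} (hs : s.Prime) (hs2 : s ≠ 2) (hn : Odd n)
    (ho : orderOf (Fintype.card F : ZMod s) = n)
    {A : Matrix (Fin n ⊕ Fin n) (Fin n ⊕ Fin n) F}
    (hA : A ∈ Matrix.symplecticGroup (Fin n) F) (hk : orderOf (A ^ k) = s) (hsF : (s : F) ≠ 0)
    (hd : d ∣ 2) (hm : d * m = Fintype.card F ^ n - 1) : A ^ m = 1 ∨ A ^ m = -1 := by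
  classical
  have : Fact s.Prime := ⟨hs⟩
  set q := Fintype.card F with hq
  have hneg := ZMod.pow_ne_neg_pow_of_odd_orderOf hs2 ho hn
  obtain ⟨x, hx, hxk⟩ := A.exists_charpoly_root_orderOf_pow (E := AlgebraicClosure F) hs hsF hk
  obtain ⟨hx0, hxinv⟩ := SymplecticGroup.aeval_inv_charpoly hA hx
  have hfr := FiniteField.aeval_pow_card_pow_eq_zero hx
  have hcongr : ∀ i j, x ^ q ^ i = x ^ q ^ j → (q : ZMod s) ^ i = (q : ZMod s) ^ j :=
      fun i j hij ↦ by
    have h : (x ^ k) ^ q ^ i = (x ^ k) ^ q ^ j := by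
      rw [pow_right_comm, pow_right_comm x k]
      exact congrArg (· ^ k) hij
    rw [IsOfFinOrder.pow_eq_pow_iff_modEq (orderOf_pos_iff.1 (hxk ▸ hs.pos)), hxk,
      ← ZMod.natCast_eq_natCast_iff] at h
    exact_mod_cast h
  have hne : ∀ i j, x ^ q ^ i ≠ (x ^ q ^ j)⁻¹ := fun i j hij ↦ by
    have h1 : s ∣ q ^ i + q ^ j := by
      rw [← hxk]
      apply orderOf_dvd_of_pow_eq_one
      rw [pow_right_comm, pow_add, hij, inv_mul_cancel₀ (pow_ne_zero _ hx0), one_pow]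
    apply hneg i j
    rw [eq_neg_iff_add_eq_zero]
    exact_mod_cast (ZMod.natCast_eq_zero_iff _ _).2 h1
  have hinj : Set.InjOn (fun i ↦ x ^ q ^ i) (Finset.range n) := fun i hi j hj hij ↦ by
    rw [Finset.coe_range] at hi hj
    exact pow_injOn_Iio_orderOf (ho ▸ hi) (ho ▸ hj) (hcongr i j hij)
  have hinj' : Set.InjOn (fun i ↦ (x ^ q ^ i)⁻¹) (Finset.range n) := fun i hi j hj hij ↦
    hinj hi hj (inv_injective hij)
  set S₁ := (Finset.range n).image fun i ↦ x ^ q ^ i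
  set S₂ := (Finset.range n).image fun i ↦ (x ^ q ^ i)⁻¹
  have hdisj : Disjoint S₁ S₂ := Finset.disjoint_left.2 fun y hy hy' ↦ by
    obtain ⟨i, -, rfl⟩ := Finset.mem_image.1 hy
    obtain ⟨j, -, h⟩ := Finset.mem_image.1 hy'
    exact hne i j h.symm
  have hcard : (S₁ ∪ S₂).card = Fintype.card (Fin n ⊕ Fin n) := by
    rw [Finset.card_union_of_disjoint hdisj, Finset.card_image_of_injOn hinj,
      Finset.card_image_of_injOn hinj']
    simp
  have hSx : ∀ y ∈ S₁ ∪ S₂, ∃ i < n, y = x ^ q ^ i ∨ y = (x ^ q ^ i)⁻¹ := fun y hy ↦ by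
    rcases Finset.mem_union.1 hy with hy | hy <;> obtain ⟨i, hi, rfl⟩ := Finset.mem_image.1 hy
    exacts [⟨i, Finset.mem_range.1 hi, .inl rfl⟩, ⟨i, Finset.mem_range.1 hi, .inr rfl⟩]
  have hSroot : ∀ y ∈ S₁ ∪ S₂, aeval y A.charpoly = 0 := fun y hy ↦ by
    obtain ⟨i, -, rfl | rfl⟩ := hSx y hy
    exacts [hfr i, inv_pow x _ ▸ FiniteField.aeval_pow_card_pow_eq_zero hxinv i]
  obtain ⟨i, hi, hix | hix⟩ := hSx _ (A.mem_of_aeval_charpoly_eq_zero _ hcard hSroot (hfr n))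
  swap
  · exact absurd hix (hne _ _)
  have hi0 : i = 0 := by
    have h := hcongr _ _ hix
    rw [← ho, pow_orderOf_eq_one, eq_comm, ← orderOf_dvd_iff_pow_eq_one, ho] at h
    exact Nat.eq_zero_of_dvd_of_lt h hi
  have hx1 : x ^ (q ^ n - 1) = 1 := by
    have hpos : 0 < q ^ n := pow_pos Fintype.card_pos n
    apply mul_right_cancel₀ hx0
    rw [← pow_succ, Nat.sub_add_cancel hpos, one_mul]
    simpa [hi0] using hix
  exact Matrix.pow_eq_one_or_neg_one_of_charpoly_roots _ hcard hSroot hd (hm ▸ hx1) fun y hy ↦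
    (hSx y hy).imp fun _ h ↦ h.2

end SpectrumArguments

section SpecialLinear

open Matrix

/-- The embedding of `SL₂(K)` into `Sp₂ₙ(F)` given by a basis and its trace-dual basis. -/
theorem SymplecticGroup.exists_injective_specialLinearGroup_two {F K ι : Type*} [Field F] [Field K]
    [Algebra F K] [FiniteDimensional F K] [Algebra.IsSeparable F K] [Fintype ι] [DecidableEq ι]
    (b : Module.Basis ι F K) :
    ∃ Φ : SpecialLinearGroup (Fin 2) K →* symplecticGroup ι F,
      Function.Injective Φ ∧ (Φ (-1) : Matrix (ι ⊕ ι) (ι ⊕ ι) F) = -1 := by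
  set P : Matrix ι ι F := Algebra.traceMatrix F b with hP
  set L := Algebra.leftMulMatrix b with hL
  have hPdet : IsUnit P.det := by
    rw [isUnit_iff_ne_zero, hP, Algebra.traceMatrix_of_basis]
    exact (LinearMap.BilinForm.nondegenerate_iff_det_ne_zero b).1 (traceForm_nondegenerate F K)
  have hPT : Pᵀ = P := by
    ext i j
    simp [hP, Algebra.traceMatrix_apply, Algebra.traceForm_apply, mul_comm]
  have hPLapp : ∀ x i j, (P * L x) i j = Algebra.trace F K (b i * (x * b j)) := by
    intro x i j
    rw [mul_comm, ← congrFun (Algebra.traceMatrix_of_basis_mulVec b (x * b j)) i]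
    simp only [Matrix.mul_apply, hL, Algebra.leftMulMatrix_eq_repr_mul, mulVec, dotProduct,
      Module.Basis.equivFun_apply, hP]
  have hPL : ∀ x, (L x)ᵀ * P = P * L x := by
    intro x
    have : (L x)ᵀ * P = (P * L x)ᵀ := by rw [transpose_mul, hPT]
    rw [this]
    ext i j
    rw [transpose_apply, hPLapp, hPLapp]
    congr 1
    ring
  have hPP : P * P⁻¹ = 1 := mul_nonsing_inv P hPdet
  have hPP' : P⁻¹ * P = 1 := nonsing_inv_mul P hPdet
  have hPPc : ∀ X, P⁻¹ * (P * X) = X := fun X ↦ by rw [← Matrix.mul_assoc, hPP', Matrix.one_mul]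
  have hPLc : ∀ x X, (L x)ᵀ * (P * X) = P * (L x * X) := fun x X ↦ by
    rw [← Matrix.mul_assoc, hPL, Matrix.mul_assoc]
  have hLc : ∀ x y X, L x * (L y * X) = L (x * y) * X := fun x y X ↦ by
    rw [← Matrix.mul_assoc, ← map_mul]
  have hPiT : (P⁻¹)ᵀ = P⁻¹ := by rw [transpose_nonsing_inv, hPT]
  let f : Matrix (Fin 2) (Fin 2) K → Matrix (ι ⊕ ι) (ι ⊕ ι) F := fun M ↦
    fromBlocks (L (M 0 0)) (L (M 0 1) * P⁻¹) (P * L (M 1 0)) (P * (L (M 1 1) * P⁻¹))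
  have hf1 : f 1 = 1 := by simp [f, hPP]
  have hmul : ∀ M N, f (M * N) = f M * f N := by
    intro M N
    simp only [f, fromBlocks_multiply, Matrix.mul_assoc, hPPc, hLc, Matrix.mul_apply,
      Fin.sum_univ_two, map_add, Matrix.add_mul, Matrix.mul_add, ← map_mul]
  have hmem : ∀ M : SpecialLinearGroup (Fin 2) K, f M ∈ symplecticGroup ι F := by
    intro M
    have hdet := M.det_coe
    rw [det_fin_two] at hdet
    rw [SymplecticGroup.fromBlocks_mem_iff]
    simp only [transpose_mul, hPT, hPiT, Matrix.mul_assoc, hPPc, hPLc, hPL, hLc]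
    refine ⟨?_, ?_, ?_⟩
    · rw [← map_mul, ← map_mul, mul_comm]
    · rw [mul_comm]
    · rw [← Matrix.mul_sub, ← Matrix.sub_mul, ← map_sub, mul_comm (M 1 0), hdet, map_one,
        Matrix.one_mul, hPP]
  have hLinj : Function.Injective L := Algebra.leftMulMatrix_injective b
  refine ⟨⟨⟨fun M ↦ ⟨f M, hmem M⟩, Subtype.ext (by simpa using hf1)⟩,
    fun M N ↦ Subtype.ext (by simpa using hmul M N)⟩, ?_, ?_⟩
  · intro M N h
    have h' : f M = f N := congrArg Subtype.val h
    obtain ⟨h1, h2, h3, h4⟩ := fromBlocks_inj.1 h'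
    have hcl : ∀ X Y, P * X = P * Y → X = Y := fun X Y h ↦ by rw [← hPPc X, h, hPPc]
    have hcr : ∀ X Y, X * P⁻¹ = Y * P⁻¹ → X = Y := fun X Y h ↦ by
      rw [← Matrix.mul_one X, ← hPP', ← Matrix.mul_assoc, h, Matrix.mul_assoc, hPP', Matrix.mul_one]
    ext i j
    fin_cases i <;> fin_cases j
    exacts [hLinj h1, hLinj (hcr _ _ h2), hLinj (hcl _ _ h3), hLinj (hcr _ _ (hcl _ _ h4))]
  · change f (-1 : SpecialLinearGroup (Fin 2) K) = -1
    have hneg : ∀ M, f (-M) = - f M := fun M ↦ by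
      simp [f, fromBlocks_neg]
    rw [SpecialLinearGroup.coe_neg, hneg]
    exact congrArg Neg.neg hf1

theorem Matrix.SpecialLinearGroup.eq_one_or_neg_one_of_sq_eq_one {K : Type*} [Field K]
    (h2 : (2 : K) ≠ 0) {x : SpecialLinearGroup (Fin 2) K} (hx : x ^ 2 = 1) : x = 1 ∨ x = -1 := by
  have hdet := x.det_coe
  rw [det_fin_two] at hdet
  have hsq : ∀ i j, ∑ k, x i k * x k j = (1 : Matrix (Fin 2) (Fin 2) K) i j := fun i j ↦ by
    rw [← Matrix.mul_apply, ← SpecialLinearGroup.coe_mul, ← pow_two, hx,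
      SpecialLinearGroup.coe_one]
  have h00 := hsq 0 0
  have h01 := hsq 0 1
  have h10 := hsq 1 0
  have h11 := hsq 1 1
  simp only [Fin.sum_univ_two, one_apply_eq, ne_eq, zero_ne_one, one_ne_zero, not_false_eq_true,
    one_apply_ne] at h00 h01 h10 h11
  have htr : x 0 0 + x 1 1 ≠ 0 := fun h ↦ h2 (by linear_combination -h00 - hdet + x 0 0 * h)
  have hb : x 0 1 = 0 := (mul_eq_zero.1 (by linear_combination h01 :
    x 0 1 * (x 0 0 + x 1 1) = 0)).resolve_right htr
  have hc : x 1 0 = 0 := (mul_eq_zero.1 (by linear_combination h10 :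
    x 1 0 * (x 0 0 + x 1 1) = 0)).resolve_right htr
  rw [hb, zero_mul, add_zero, mul_self_eq_one_iff] at h00
  rw [hb, zero_mul, sub_zero] at hdet
  rcases h00 with h | h
  · left
    ext i j
    fin_cases i <;> fin_cases j
    exacts [h, hb, hc, by simpa [h] using hdet]
  · right
    ext i j
    fin_cases i <;> fin_cases j
    exacts [by simpa using h, by simpa using hb, by simpa using hc, by
      rw [h] at hdet
      simpa using (show x 1 1 = -1 by linear_combination -hdet)]

theorem Matrix.SpecialLinearGroup.exists_orderOf_eq_card_sub_one (K : Type*) [Field K] [Finite K] :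
    ∃ x : SpecialLinearGroup (Fin 2) K, orderOf x = Nat.card K - 1 := by
  obtain ⟨u, hu⟩ := IsCyclic.exists_generator (α := Kˣ)
  let φ : Kˣ →* SpecialLinearGroup (Fin 2) K :=
    { toFun := fun u ↦ ⟨diagonal ![(u : K), ((u⁻¹ : Kˣ) : K)], by simp [det_diagonal]⟩
      map_one' := by ext i j; fin_cases i <;> fin_cases j <;> simp
      map_mul' := fun u v ↦ by
        refine Subtype.ext (?_ : diagonal _ = diagonal _ * diagonal _)
        rw [diagonal_mul_diagonal]
        congr 1
        funext i
        fin_cases i <;> simp [mul_comm] }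
  have hφ : Function.Injective φ := fun u v h ↦ by
    exact Units.ext (congrArg (fun M : SpecialLinearGroup (Fin 2) K ↦ M 0 0) h :)
  exact ⟨φ u, by rw [orderOf_injective φ hφ, orderOf_eq_card_of_forall_mem_zpowers hu,
    Nat.card_units]⟩

theorem Matrix.SpecialLinearGroup.exists_orderOf_eq_card_add_one (K : Type*) [Field K] [Finite K] :
    ∃ x : SpecialLinearGroup (Fin 2) K, orderOf x = Nat.card K + 1 := by
  obtain ⟨p, hp⟩ := CharP.exists K
  have : Fact p.Prime := ⟨CharP.char_is_prime K p⟩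
  let E := FiniteField.Extension K p 2
  have hEcard : Nat.card E = Nat.card K ^ 2 := FiniteField.natCard_extension K p 2
  let b : Module.Basis (Fin 2) K E :=
    Module.finBasisOfFinrankEq K E (FiniteField.finrank_extension K p 2)
  obtain ⟨u, hu⟩ := IsCyclic.exists_generator (α := Eˣ)
  have huord := orderOf_eq_card_of_forall_mem_zpowers hu
  have hK : 1 < Nat.card K := Finite.one_lt_card
  have hfac : Nat.card K ^ 2 - 1 = (Nat.card K + 1) * (Nat.card K - 1) := by
    simpa using Nat.sq_sub_sq (Nat.card K) 1
  rw [Nat.card_units, hEcard, hfac] at huord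
  set v : E := ((u ^ (Nat.card K - 1) : Eˣ) : E) with hv
  have hvord : orderOf v = Nat.card K + 1 := by
    rw [hv, orderOf_units, orderOf_pow_of_dvd (by omega) (huord ▸ dvd_mul_left _ _), huord,
      Nat.mul_div_cancel _ (by omega)]
  have hnorm : Algebra.norm K v = 1 := by
    apply (algebraMap K E).injective
    rw [FiniteField.algebraMap_norm_eq_pow, hEcard, hfac, Nat.mul_div_cancel _ (by omega), map_one,
      ← hvord, pow_orderOf_eq_one]
  let x : SpecialLinearGroup (Fin 2) K :=
    ⟨Algebra.leftMulMatrix b v, by rw [← Algebra.norm_eq_matrix_det, hnorm]⟩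
  refine ⟨x, ?_⟩
  rw [← hvord, ← orderOf_injective (Algebra.leftMulMatrix b).toRingHom.toMonoidHom
    (Algebra.leftMulMatrix_injective b) v,
    ← orderOf_injective SpecialLinearGroup.coeMonoidHom
      SpecialLinearGroup.coeMonoidHom_injective x]
  rfl

theorem Matrix.SpecialLinearGroup.eq_one_or_neg_one_of_mem_center {K : Type*} [Field K]
    {x : SpecialLinearGroup (Fin 2) K} (hx : x ∈ Subgroup.center (SpecialLinearGroup (Fin 2) K)) :
    x = 1 ∨ x = -1 := by
  obtain ⟨r, hr, hrx⟩ := SpecialLinearGroup.mem_center_iff.1 hx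
  rw [Fintype.card_fin, sq, mul_self_eq_one_iff] at hr
  rcases hr with rfl | rfl
  · left
    exact Subtype.ext (by simpa using hrx.symm)
  · right
    rw [map_neg, map_one] at hrx
    exact Subtype.ext hrx.symm

theorem SymplecticGroup.orderOf_mk_center {F K l : Type*} [Field F] [Field K]
    [Fintype l] [DecidableEq l]
    (Φ : SpecialLinearGroup (Fin 2) K →* symplecticGroup l F) (hΦ : Function.Injective Φ)
    (hneg : (Φ (-1) : Matrix (l ⊕ l) (l ⊕ l) F) = -1) {x : SpecialLinearGroup (Fin 2) K} {m d : ℕ}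
    (hx : orderOf x = d * m) (hd : d = 1 ∧ (2 : K) = 0 ∨ d = 2 ∧ (2 : K) ≠ 0) :
    orderOf (QuotientGroup.mk' (Subgroup.center (symplecticGroup l F)) (Φ x)) = m := by
  apply Nat.dvd_antisymm
  · apply orderOf_dvd_of_pow_eq_one
    rw [← map_pow, ← map_pow, ← MonoidHom.mem_ker, QuotientGroup.ker_mk']
    have hxm : x ^ m = 1 ∨ x ^ m = -1 := by
      rcases hd with ⟨rfl, -⟩ | ⟨rfl, h2⟩
      · left
        rw [← one_mul m, ← hx, pow_orderOf_eq_one]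
      · apply SpecialLinearGroup.eq_one_or_neg_one_of_sq_eq_one h2
        rw [← pow_mul, mul_comm, ← hx, pow_orderOf_eq_one]
    rcases hxm with h | h
    · rw [h, map_one]
      exact one_mem _
    · rw [h, Subgroup.mem_center_iff]
      intro g
      exact Subtype.ext (by simp [hneg])
  · set y := QuotientGroup.mk' (Subgroup.center (symplecticGroup l F)) (Φ x) with hy
    set j := orderOf y with hj
    have hyj : y ^ j = 1 := pow_orderOf_eq_one y
    rw [hy, ← map_pow, ← map_pow, ← MonoidHom.mem_ker, QuotientGroup.ker_mk',
      Subgroup.mem_center_iff] at hyj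
    have hxj : x ^ j = 1 ∨ x ^ j = -1 := by
      apply SpecialLinearGroup.eq_one_or_neg_one_of_mem_center
      rw [Subgroup.mem_center_iff]
      intro g
      apply hΦ
      rw [map_mul, map_mul, hyj]
    rcases hd with ⟨rfl, h2⟩ | ⟨rfl, -⟩
    · have h11 : (-1 : SpecialLinearGroup (Fin 2) K) = 1 := by
        have h11 : (-1 : K) = 1 := by linear_combination -h2
        ext i j
        fin_cases i <;> fin_cases j <;> simp [h11]
      rw [h11, or_self] at hxj
      simpa [hx] using orderOf_dvd_of_pow_eq_one hxj
    · have hx2 : x ^ (2 * j) = 1 := by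
        rw [mul_comm, pow_mul]
        rcases hxj with h | h <;> simp [h]
      have := orderOf_dvd_of_pow_eq_one hx2
      rw [hx] at this
      exact Nat.dvd_of_mul_dvd_mul_left two_pos this

end SpecialLinear

theorem ZMod.ne_two_of_one_lt_orderOf {s : ℕ} {a : ZMod s} (ha : 1 < orderOf a) : s ≠ 2 := by
  rintro rfl
  have : a = 0 ∨ a = 1 := by clear ha; revert a; decide
  rcases this with rfl | rfl <;> simp at ha

theorem FiniteField.natCast_ne_zero_of_orderOf_card_pos {F : Type*} [Field F] [Fintype F] {s : ℕ}
    (hs : s.Prime) (ho : 0 < orderOf (Fintype.card F : ZMod s)) : (s : F) ≠ 0 := by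
  intro h0
  have : Fact s.Prime := ⟨hs⟩
  obtain ⟨p, hp⟩ := CharP.exists F
  have hpp := CharP.char_is_prime F p
  obtain rfl : p = s := (Nat.prime_dvd_prime_iff_eq hpp hs).1 ((CharP.cast_eq_zero_iff F p s).1 h0)
  obtain ⟨k, -, hk⟩ := FiniteField.card F p
  rw [hk, Nat.cast_pow, ZMod.natCast_self, zero_pow k.ne_zero, orderOf_zero] at ho
  exact lt_irrefl _ ho

theorem FiniteField.gcd_two_card_sub_one (F : Type*) [Field F] [Fintype F] :
    Nat.gcd 2 (Fintype.card F - 1) = 1 ∧ (2 : F) = 0 ∧ Even (Fintype.card F) ∨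
      Nat.gcd 2 (Fintype.card F - 1) = 2 ∧ (2 : F) ≠ 0 ∧ Odd (Fintype.card F) := by
  have hpos : 0 < Fintype.card F := Fintype.card_pos
  by_cases h2 : (2 : F) = 0
  · left
    have hchar : ringChar F = 2 :=
      CharP.ringChar_of_prime_eq_zero Nat.prime_two (by exact_mod_cast h2)
    have heven := FiniteField.even_card_of_char_two hchar
    refine ⟨(Nat.coprime_two_left).2 ?_, h2, Nat.even_iff.2 heven⟩
    rw [Nat.odd_iff]
    omega
  · right
    have hodd := FiniteField.odd_card_of_char_ne_two (F := F) fun h ↦ h2 <| by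
      have := CharP.cast_eq_zero F (ringChar F)
      rw [h] at this
      exact_mod_cast this
    refine ⟨Nat.gcd_eq_left (by omega), h2, Nat.odd_iff.2 hodd⟩

theorem FiniteField.gcd_two_dvd_card_pow (F : Type*) [Field F] [Fintype F] (n : ℕ) :
    Nat.gcd 2 (Fintype.card F - 1) ∣ Fintype.card F ^ n + 1 ∧
      Nat.gcd 2 (Fintype.card F - 1) ∣ Fintype.card F ^ n - 1 := by
  rcases FiniteField.gcd_two_card_sub_one F with ⟨h, -⟩ | ⟨h, -, ho⟩
  · simp [h]
  · rw [h]
    exact ⟨(ho.pow.add_odd odd_one).two_dvd, (Nat.Odd.sub_odd ho.pow odd_one).two_dvd⟩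

theorem FiniteField.coprime_card_pow_div_gcd_two (F : Type*) [Field F] [Fintype F] {n : ℕ}
    (hn : n ≠ 0) :
    Nat.Coprime ((Fintype.card F ^ n + 1) / Nat.gcd 2 (Fintype.card F - 1))
      ((Fintype.card F ^ n - 1) / Nat.gcd 2 (Fintype.card F - 1)) := by
  have hpos : 0 < Fintype.card F ^ n := pow_pos Fintype.card_pos n
  rcases FiniteField.gcd_two_card_sub_one F with ⟨h, -, he⟩ | ⟨h, -, ho⟩
  · have he' := he.pow_of_ne_zero hn
    rw [h, Nat.div_one, Nat.div_one,
      show Fintype.card F ^ n + 1 = 2 + (Fintype.card F ^ n - 1) by omega,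
      Nat.coprime_add_self_left, Nat.coprime_two_left, Nat.odd_iff]
    rw [Nat.even_iff] at he'
    omega
  · have ho' := Nat.odd_iff.1 (ho.pow (n := n))
    rw [h, show (Fintype.card F ^ n + 1) / 2 = 1 + (Fintype.card F ^ n - 1) / 2 by omega,
      Nat.coprime_add_self_left]
    exact Nat.coprime_one_left _

theorem PSp.exists_lift_orderOf_pow {n : ℕ} {F : Type*} [Field F] [Fintype F] {s : ℕ}
    (hs : s.Prime) (g : PSp n F) (hg : s ∣ orderOf g) :
    ∃ x : Matrix.symplecticGroup (Fin n) F, (x : PSp n F) = g ∧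
      ∃ k, orderOf ((x : Matrix (Fin n ⊕ Fin n) (Fin n ⊕ Fin n) F) ^ k) = s := by
  obtain ⟨x, rfl⟩ := QuotientGroup.mk_surjective g
  refine ⟨x, rfl, orderOf x / s, ?_⟩
  have hdvd : s ∣ orderOf x := hg.trans
    (orderOf_map_dvd (QuotientGroup.mk' (Subgroup.center (Matrix.symplecticGroup (Fin n) F))) x)
  have : Finite (Matrix.symplecticGroup (Fin n) F) := Subtype.finite
  have hpos : orderOf x ≠ 0 := (orderOf_pos x).ne'
  rw [← SubmonoidClass.coe_pow, orderOf_submonoid,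
    orderOf_pow_of_dvd (Nat.div_pos (Nat.le_of_dvd (Nat.pos_of_ne_zero hpos) hdvd) hs.pos).ne'
      (Nat.div_dvd_of_dvd hdvd), Nat.div_div_self hdvd hpos]

theorem PSp.mk_pow_eq_one {n : ℕ} {F : Type*} [Field F] {m : ℕ}
    (x : Matrix.symplecticGroup (Fin n) F)
    (hx : (x : Matrix (Fin n ⊕ Fin n) (Fin n ⊕ Fin n) F) ^ m = 1 ∨
      (x : Matrix (Fin n ⊕ Fin n) (Fin n ⊕ Fin n) F) ^ m = -1) : (x : PSp n F) ^ m = 1 := by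
  rw [← QuotientGroup.mk_pow, QuotientGroup.eq_one_iff, Subgroup.mem_center_iff]
  intro g
  apply Subtype.ext
  rw [Submonoid.coe_mul, Submonoid.coe_mul, SubmonoidClass.coe_pow]
  rcases hx with h | h <;> simp [h]

theorem PSp.exists_orderOf_eq {n : ℕ} (hn : n ≠ 0) {F : Type} [Field F] [Fintype F] :
    (Fintype.card F ^ n + 1) / Nat.gcd 2 (Fintype.card F - 1) ∈ elementOrders (PSp n F) ∧
      (Fintype.card F ^ n - 1) / Nat.gcd 2 (Fintype.card F - 1) ∈ elementOrders (PSp n F) := by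
  obtain ⟨p, hp⟩ := CharP.exists F
  have : Fact p.Prime := ⟨CharP.char_is_prime F p⟩
  have : NeZero n := ⟨hn⟩
  let K := FiniteField.Extension F p n
  have hKcard : Nat.card K = Fintype.card F ^ n := by
    rw [← Nat.card_eq_fintype_card]
    exact FiniteField.natCard_extension F p n
  obtain ⟨Φ, hΦ, hneg⟩ := SymplecticGroup.exists_injective_specialLinearGroup_two
    (Module.finBasisOfFinrankEq F K (FiniteField.finrank_extension F p n))
  have h2K : (2 : K) = 0 ↔ (2 : F) = 0 := by
    rw [← map_ofNat (algebraMap F K) 2, map_eq_zero]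
  have hd := FiniteField.gcd_two_card_sub_one F
  have hd' : Nat.gcd 2 (Fintype.card F - 1) = 1 ∧ (2 : K) = 0 ∨
      Nat.gcd 2 (Fintype.card F - 1) = 2 ∧ (2 : K) ≠ 0 := by
    rw [ne_eq, h2K]
    tauto
  obtain ⟨hdvd₁, hdvd₂⟩ := FiniteField.gcd_two_dvd_card_pow F n
  obtain ⟨x, hx⟩ := Matrix.SpecialLinearGroup.exists_orderOf_eq_card_add_one K
  obtain ⟨y, hy⟩ := Matrix.SpecialLinearGroup.exists_orderOf_eq_card_sub_one K
  rw [hKcard] at hx hy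
  exact ⟨⟨_, SymplecticGroup.orderOf_mk_center Φ hΦ hneg
      (hx.trans (Nat.mul_div_cancel' hdvd₁).symm) hd'⟩,
    ⟨_, SymplecticGroup.orderOf_mk_center Φ hΦ hneg
      (hy.trans (Nat.mul_div_cancel' hdvd₂).symm) hd'⟩⟩

/-- For `L = PSp_{2n}(q)`, `n ≥ 5` odd, and primes `s₁, s₂` with
`ord_{s₁}(q) = 2n` and `ord_{s₂}(q) = n`: the neighborhoods of `s₁` and `s₂` in
the prime graph of `L` are disjoint, and the elements of `ω(L)` divisible by
`sᵢ` are exactly the divisors of `mᵢ` that are so divisible, where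
`m₁ = (qⁿ+1)/(2,q-1)` and `m₂ = (qⁿ-1)/(2,q-1)`. -/
theorem psp_odd_disjoint_neighborhoods
    (q : ℕ) (hq : IsPrimePow q) (n : ℕ) (hn : 5 ≤ n) (hnodd : Odd n)
    (F : Type) [Field F] [Fintype F] (hF : Fintype.card F = q)
    (s1 s2 : ℕ) (hs1 : s1.Prime) (hs2 : s2.Prime)
    (ho1 : orderOf ((q : ZMod s1)) = 2 * n) (ho2 : orderOf ((q : ZMod s2)) = n) :
    (s1 * s2 ∉ elementOrders (PSp n F) ∧
      ¬ ∃ r : ℕ, r.Prime ∧ r * s1 ∈ elementOrders (PSp n F) ∧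
        r * s2 ∈ elementOrders (PSp n F)) ∧
    ((q ^ n + 1) / Nat.gcd 2 (q - 1) ∈ elementOrders (PSp n F) ∧
      ∀ a ∈ elementOrders (PSp n F), s1 ∣ a → a ∣ (q ^ n + 1) / Nat.gcd 2 (q - 1)) ∧
    ((q ^ n - 1) / Nat.gcd 2 (q - 1) ∈ elementOrders (PSp n F) ∧
      ∀ a ∈ elementOrders (PSp n F), s2 ∣ a → a ∣ (q ^ n - 1) / Nat.gcd 2 (q - 1)) := by
  subst hF
  have hn0 : n ≠ 0 := by omega
  obtain ⟨hdvd₁, hdvd₂⟩ := FiniteField.gcd_two_dvd_card_pow F n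
  have hd : Nat.gcd 2 (Fintype.card F - 1) ∣ 2 := Nat.gcd_dvd_left _ _
  have hcop := FiniteField.coprime_card_pow_div_gcd_two F hn0
  obtain ⟨hmem₁, hmem₂⟩ := PSp.exists_orderOf_eq hn0 (F := F)
  have h₁ : ∀ a ∈ elementOrders (PSp n F), s1 ∣ a →
      a ∣ (Fintype.card F ^ n + 1) / Nat.gcd 2 (Fintype.card F - 1) := by
    rintro _ ⟨g, rfl⟩ hg
    obtain ⟨x, rfl, k, hk⟩ := PSp.exists_lift_orderOf_pow hs1 g hg
    exact orderOf_dvd_of_pow_eq_one <| PSp.mk_pow_eq_one x <|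
      SymplecticGroup.pow_eq_one_or_neg_one_of_orderOf_eq_two_mul hs1
        (ZMod.ne_two_of_one_lt_orderOf (by rw [ho1]; omega)) ho1 x.2 hk
        (FiniteField.natCast_ne_zero_of_orderOf_card_pos hs1 (by omega)) hd
        (Nat.mul_div_cancel' hdvd₁)
  have h₂ : ∀ a ∈ elementOrders (PSp n F), s2 ∣ a →
      a ∣ (Fintype.card F ^ n - 1) / Nat.gcd 2 (Fintype.card F - 1) := by
    rintro _ ⟨g, rfl⟩ hg
    obtain ⟨x, rfl, k, hk⟩ := PSp.exists_lift_orderOf_pow hs2 g hg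
    exact orderOf_dvd_of_pow_eq_one <| PSp.mk_pow_eq_one x <|
      SymplecticGroup.pow_eq_one_or_neg_one_of_orderOf_eq hs2
        (ZMod.ne_two_of_one_lt_orderOf (by rw [ho2]; omega)) hnodd ho2 x.2 hk
        (FiniteField.natCast_ne_zero_of_orderOf_card_pos hs2 (by omega)) hd
        (Nat.mul_div_cancel' hdvd₂)
  refine ⟨⟨fun h ↦ ?_, ?_⟩, ⟨hmem₁, h₁⟩, hmem₂, h₂⟩
  · exact Nat.not_coprime_of_dvd_of_dvd hs1.one_lt
      ((dvd_mul_right _ _).trans (h₁ _ h (dvd_mul_right _ _)))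
      ((dvd_mul_right _ _).trans (h₂ _ h (dvd_mul_left _ _))) hcop
  · rintro ⟨r, hr, hr₁, hr₂⟩
    exact Nat.not_coprime_of_dvd_of_dvd hr.one_lt
      ((dvd_mul_right _ _).trans (h₁ _ hr₁ (dvd_mul_left _ _)))
      ((dvd_mul_right _ _).trans (h₂ _ hr₂ (dvd_mul_left _ _))) hcop
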